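/- Let p be a prime, n ≥ 1, and let Q be a simple quandle with Nat.card Q = p^n and Nat.card Q > 2. Then Q is isomorphic to an affine latin quandle over the elementary abelian group (ZMod p)^n with an irreducibly acting automorphism: there exist a ZMod p-linear automorphism f of (Fin n → ZMod p) whose only invariant submodules are ⊥ and ⊤, and a bijection e : Q ≃ (Fin n → ZMod p) with e (x ◃ y) = e x - f (e x) + f (e y) for all x, y ∈ Q; moreover Q is latin. -/

import Mathlib

open Quandles

/-- Left multiplication by `a` as a permutation of the quandle. -/
def QL {Q : Type*} [Quandle Q] (a : Q) : Equiv.Perm Q := Rack.act' a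

/-- The displacement group of a quandle: the subgroup of `Equiv.Perm Q`
generated by `{L a * (L b)⁻¹ : a, b ∈ Q}`. -/
def Dis (Q : Type*) [Quandle Q] : Subgroup (Equiv.Perm Q) :=
  Subgroup.closure {g : Equiv.Perm Q | ∃ a b : Q, g = QL a * (QL b)⁻¹}

/-- A congruence of a quandle: an equivalence relation compatible with `◃` and `◃⁻¹`. -/
structure QuandleCongruence (Q : Type*) [Quandle Q] where
  rel : Q → Q → Prop
  iseqv : Equivalence rel
  act_compat : ∀ {a b c d : Q}, rel a b → rel c d → rel (a ◃ c) (b ◃ d)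
  invAct_compat : ∀ {a b c d : Q}, rel a b → rel c d → rel (a ◃⁻¹ c) (b ◃⁻¹ d)

/-- A quandle is simple if its only congruences are equality and the total relation. -/
def IsSimpleQuandle (Q : Type*) [Quandle Q] : Prop :=
  ∀ α : QuandleCongruence Q, (∀ x y : Q, α.rel x y ↔ x = y) ∨ (∀ x y : Q, α.rel x y)

lemma avg_norm_ge (m : ℕ) (hm : 0 < m) (s : Multiset ℂ) (hs : ∀ z ∈ s, z ^ m = 1)
    (hInt : IsIntegral ℤ (s.sum / (s.card : ℂ))) (h0 : s.sum ≠ 0) : (s.card : ℝ) ≤ ‖s.sum‖ := by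
  classical
  let R : Set ℂ := {z : ℂ | z ^ m = 1}
  have hR : R.Finite := by
    refine (Polynomial.nthRootsFinset m (1:ℂ)).finite_toSet.subset ?_
    intro z hz
    have hz' : z ^ m = 1 := hz
    simpa [Polynomial.mem_nthRootsFinset hm] using hz'
  have hRi : ∀ z ∈ R, IsIntegral ℚ z := fun z hz =>
    ⟨Polynomial.X ^ m - 1, by simpa using Polynomial.monic_X_pow_sub_C (1:ℚ) hm.ne', by
      have : z ^ m = 1 := hz
      simp [this]⟩
  let K := IntermediateField.adjoin ℚ R
  have : Finite R := hR
  have : FiniteDimensional ℚ K := IntermediateField.finiteDimensional_adjoin hRi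
  have : NumberField K := {}
  have hsK : ∀ z ∈ s, z ∈ K := fun z hz => IntermediateField.subset_adjoin ℚ R (hs z hz)
  lift s to Multiset K using hsK
  have hs' : ∀ z ∈ s, z ^ m = 1 := by
    intro z hz
    have := hs (z : ℂ) (Multiset.mem_map_of_mem _ hz)
    exact_mod_cast this
  set α : K := s.sum / (s.card : K) with hα
  have hsum : ((s.map ((↑) : K → ℂ)).sum) = ((s.sum : K) : ℂ) := by
    exact (map_multiset_sum K.val s).symm
  rw [hsum] at h0 hInt ⊢
  simp only [Multiset.card_map] at hInt ⊢
  have hcoe : ((α : K) : ℂ) = ((s.sum : K) : ℂ) / (s.card : ℂ) := by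
    simp [hα]
  have hαi : IsIntegral ℤ α := by
    have : IsIntegral ℤ (K.val α) := by
      show IsIntegral ℤ ((α : K) : ℂ)
      rw [hcoe]; exact hInt
    exact (isIntegral_algHom_iff (K.val.restrictScalars ℤ) Subtype.val_injective).1 this
  have hcard : (s.card : ℝ) ≠ 0 := by
    intro h
    have : s.card = 0 := by exact_mod_cast h
    rw [Multiset.card_eq_zero] at this
    subst this
    simp at h0
  have hcp : (0:ℝ) < s.card := lt_of_le_of_ne (by positivity) hcard.symm
  have hs0 : s.sum ≠ 0 := by
    intro h; apply h0; rw [h]; rfl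
  have hα0 : α ≠ 0 := by
    refine div_ne_zero hs0 ?_
    exact_mod_cast hcard
  have hle : ∀ φ : K →+* ℂ, ‖φ α‖ ≤ 1 := by
    intro φ
    rw [hα, map_div₀, map_natCast, norm_div, Complex.norm_natCast, div_le_one hcp, map_multiset_sum]
    refine (Multiset.le_sum_of_subadditive _ norm_zero.le norm_add_le _).trans ?_
    have : (Multiset.map (fun x : ℂ => ‖x‖) (Multiset.map φ s)) = Multiset.map (fun _ => (1:ℝ)) s := by
      rw [Multiset.map_map]
      refine Multiset.map_congr rfl ?_
      intro z hz
      have h1 : (φ z) ^ m = 1 := by rw [← map_pow, hs' z hz, map_one]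
      exact Complex.norm_eq_one_of_pow_eq_one h1 hm.ne'
    rw [this]
    simp
  have hnorm : (1:ℝ) ≤ ∏ φ : K →ₐ[ℚ] ℂ, ‖φ α‖ := by
    rw [← norm_prod, ← Algebra.norm_eq_prod_embeddings ℚ ℂ α]
    have h1 : IsIntegral ℤ (Algebra.norm ℚ α) := Algebra.isIntegral_norm ℚ hαi
    obtain ⟨k, hk⟩ := IsIntegrallyClosed.isIntegral_iff.1 h1
    have hk0 : k ≠ 0 := by
      rintro rfl
      apply hα0
      rw [← Algebra.norm_eq_zero_iff (R := ℚ), ← hk]; simp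
    rw [← hk]
    have : (1:ℝ) ≤ |(k:ℝ)| := by exact_mod_cast Int.one_le_abs hk0
    simpa using this
  have h2 : ∏ φ : K →ₐ[ℚ] ℂ, ‖φ α‖ ≤ ‖K.val α‖ := by
    rw [← Finset.mul_prod_erase Finset.univ (fun φ : K →ₐ[ℚ] ℂ => ‖φ α‖) (Finset.mem_univ K.val)]
    refine mul_le_of_le_one_right (norm_nonneg _) (Finset.prod_le_one (fun _ _ => norm_nonneg _) ?_)
    intro φ _
    exact hle φ.toRingHom
  have h3 : (1:ℝ) ≤ ‖((s.sum : K) : ℂ) / (s.card : ℂ)‖ := by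
    rw [← hcoe]; exact hnorm.trans h2
  rw [norm_div, Complex.norm_natCast, one_le_div hcp] at h3
  exact h3

lemma all_eq_of_norm_sum (s : Multiset ℂ) (hs : ∀ z ∈ s, ‖z‖ = 1) (hne : s.sum ≠ 0)
    (h : (s.card : ℝ) ≤ ‖s.sum‖) : ∀ z ∈ s, z = (‖s.sum‖ : ℂ) / (starRingEnd ℂ) s.sum := by
  set S := s.sum with hS
  have hle : ∀ z ∈ s, ((starRingEnd ℂ) S * z).re ≤ ‖S‖ := by
    intro z hz
    refine (Complex.re_le_norm _).trans ?_
    simp [hs z hz]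
  have hsum : (s.map (fun z => ‖S‖ - ((starRingEnd ℂ) S * z).re)).sum ≤ 0 := by
    rw [Multiset.sum_map_sub]
    have h1 : (s.map (fun z => ((starRingEnd ℂ) S * z).re)).sum = ‖S‖ ^ 2 := by
      have : (s.map (fun z => ((starRingEnd ℂ) S * z).re)).sum = ((starRingEnd ℂ) S * s.sum).re := by
        have h5 := Multiset.sum_map_mul_left (s := s) (a := (starRingEnd ℂ) S) (f := fun z => z)
        rw [Multiset.map_id'] at h5
        rw [← h5]
        have := map_multiset_sum Complex.reAddGroupHom (s.map (fun z => (starRingEnd ℂ) S * z))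
        simpa [Multiset.map_map] using this.symm
      rw [this, ← hS, mul_comm, Complex.mul_conj, Complex.ofReal_re, Complex.normSq_eq_norm_sq]
    rw [h1]
    simp
    nlinarith [norm_nonneg S]
  intro z hz
  have hz0 : ‖S‖ - ((starRingEnd ℂ) S * z).re ≤ 0 := by
    refine le_trans ?_ hsum
    refine Multiset.single_le_sum ?_ _ (Multiset.mem_map_of_mem _ hz)
    intro x hx
    obtain ⟨w, hw, rfl⟩ := Multiset.mem_map.1 hx
    exact sub_nonneg.2 (hle w hw)
  have hn : ‖(starRingEnd ℂ) S * z‖ = ‖S‖ := by simp [hs z hz]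
  have hre : ((starRingEnd ℂ) S * z).re = ‖(starRingEnd ℂ) S * z‖ := by
    rw [hn]; exact le_antisymm (hle z hz) (by linarith)
  have hS0 : (starRingEnd ℂ) S ≠ 0 := by simpa using hne
  rw [eq_div_iff hS0, mul_comm, ← hn]
  have := Complex.re_eq_norm.1 hre
  have h4 := Complex.eq_coe_norm_of_nonneg this
  exact h4
lemma scalar_of_trace {V : Type*} [AddCommGroup V] [Module ℂ V] [FiniteDimensional ℂ V]
    (x : Module.End ℂ V) (m : ℕ) (hm : 0 < m) (hx : x ^ m = 1) (P : ℕ) (ω : ℂ) (hω : ω ≠ 0)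
    (hωi : IsIntegral ℤ ω) (hP : Nat.Coprime P (Module.finrank ℂ V))
    (hN : Module.finrank ℂ V ≠ 0)
    (htr : (P : ℂ) * LinearMap.trace ℂ V x = ω * (Module.finrank ℂ V : ℂ)) :
    ∃ ζ : ℂ, x = algebraMap ℂ (Module.End ℂ V) ζ := by
  set N := Module.finrank ℂ V with hNdef
  have hsp : x.charpoly.Splits := IsAlgClosed.splits _
  have htrace := Module.End.trace_eq_sum_roots_charpoly_of_splits hsp
  have hcard : x.charpoly.roots.card = N := by
    rw [← hsp.natDegree_eq_card_roots, LinearMap.charpoly_natDegree]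
  set s := x.charpoly.roots with hs
  have hroot : ∀ z ∈ s, z ^ m = 1 := by
    intro z hz
    have hz' : x.charpoly.IsRoot z := Polynomial.isRoot_of_mem_roots hz
    rw [← Module.End.hasEigenvalue_iff_isRoot_charpoly] at hz'
    obtain ⟨v, hv⟩ := hz'.exists_hasEigenvector
    have h1 := hv.pow_apply m
    rw [hx] at h1
    have h2 : (z ^ m - 1) • v = 0 := by
      rw [sub_smul, ← h1]; simp
    rcases smul_eq_zero.1 h2 with h | h
    · exact sub_eq_zero.1 h
    · exact absurd h hv.2
  have hN' : (N : ℂ) ≠ 0 := by exact_mod_cast hN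
  have hsum0 : s.sum ≠ 0 := by
    intro h
    rw [htrace, h, mul_zero] at htr
    exact mul_ne_zero hω hN' htr.symm
  have hsi : IsIntegral ℤ s.sum := by
    refine IsIntegral.multiset_sum ?_
    intro z hz
    exact ⟨Polynomial.X ^ m - 1, by simpa using Polynomial.monic_X_pow_sub_C (1:ℤ) hm.ne', by
      simp [hroot z hz]⟩
  have hInt : IsIntegral ℤ (s.sum / (s.card : ℂ)) := by
    rw [hcard]
    have hb := Nat.gcd_eq_gcd_ab P N
    rw [hP] at hb
    have hb' : (1:ℂ) = P * (P.gcdA N : ℂ) + N * (P.gcdB N : ℂ) := by exact_mod_cast hb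
    have : s.sum / (N : ℂ) = (P.gcdA N : ℂ) * ω + (P.gcdB N : ℂ) * s.sum := by
      rw [div_eq_iff hN']
      rw [htrace] at htr
      linear_combination (s.sum) * hb' + (P.gcdA N : ℂ) * htr
    rw [this]
    exact ((isIntegral_intCast _).mul hωi).add ((isIntegral_intCast _).mul hsi)
  have hge := avg_norm_ge m hm s hroot hInt hsum0
  have hall := all_eq_of_norm_sum s
    (fun z hz => Complex.norm_eq_one_of_pow_eq_one (hroot z hz) hm.ne') hsum0 hge
  set ζ := (‖s.sum‖ : ℂ) / (starRingEnd ℂ) s.sum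
  refine ⟨ζ, ?_⟩
  have hrep : s = Multiset.replicate N ζ := Multiset.eq_replicate.2 ⟨hcard, hall⟩
  have hcp : x.charpoly = (Polynomial.X - Polynomial.C ζ) ^ N := by
    rw [hsp.eq_prod_roots_of_monic x.charpoly_monic, ← hs, hrep]
    simp
  have hd1 : minpoly ℂ x ∣ (Polynomial.X - Polynomial.C ζ) ^ N := by
    rw [← hcp]; exact LinearMap.minpoly_dvd_charpoly x
  have hd2 : minpoly ℂ x ∣ Polynomial.X ^ m - 1 := by
    apply minpoly.dvd
    simp [hx]
  have hsq : Squarefree (minpoly ℂ x) := by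
    refine Squarefree.squarefree_of_dvd hd2 ?_
    have := (Polynomial.separable_X_pow_sub_C (1:ℂ) (n := m) (by exact_mod_cast hm.ne') one_ne_zero).squarefree
    simpa using this
  have hd3 := (hsq.dvd_pow_iff_dvd hN).1 hd1
  obtain ⟨q, hq⟩ := hd3
  have := congrArg (Polynomial.aeval x) hq
  rw [map_mul, minpoly.aeval, zero_mul] at this
  simp only [map_sub, Polynomial.aeval_X, Polynomial.aeval_C] at this
  exact sub_eq_zero.1 this

open Quandles in
lemma quandle_rep_dvd {Q : Type*} [Quandle Q] [Fintype Q] {p n : ℕ} (hp : p.Prime)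
    (hcard : Fintype.card Q = p ^ n)
    (hconn : ∀ φ : Q → ℂ, (∀ a b, φ (a ◃ b) = φ b) → ∀ a b, φ a = φ b)
    {V : Type*} [AddCommGroup V] [Module ℂ V] [FiniteDimensional ℂ V]
    (T : Q → Module.End ℂ V) (m : ℕ) (hm : 0 < m) (hT : ∀ a, T a ^ m = 1)
    (hTT : ∀ a b, T (a ◃ b) * T a = T a * T b) (ω : ℂ) (hω : ω ≠ 0) (hωi : IsIntegral ℤ ω)
    (hnil : IsNilpotent ((∑ a, T a) - algebraMap ℂ (Module.End ℂ V) ω))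
    (hno : ∀ v : V, (∀ a b, T a v = T b v) → v = 0) : p ∣ Module.finrank ℂ V := by
  by_contra hnd
  have hN : Module.finrank ℂ V ≠ 0 := by rintro h; simp [h] at hnd
  have htr : ∀ a b, LinearMap.trace ℂ V (T a) = LinearMap.trace ℂ V (T b) := by
    refine hconn (fun a => LinearMap.trace ℂ V (T a)) ?_
    intro a b
    have h1 : T a * T a ^ (m-1) = 1 := by
      rw [← pow_succ', Nat.sub_add_cancel hm, hT]
    have h2 : T a ^ (m-1) * T a = 1 := by
      rw [← pow_succ, Nat.sub_add_cancel hm, hT]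
    have h3 : T (a ◃ b) = T a * (T b * T a ^ (m-1)) := by
      rw [← mul_assoc, ← hTT, mul_assoc, h1, mul_one]
    show LinearMap.trace ℂ V (T (a ◃ b)) = LinearMap.trace ℂ V (T b)
    rw [h3, LinearMap.trace_mul_comm, mul_assoc, h2, mul_one]
  have hK : LinearMap.trace ℂ V (∑ a, T a) = ω * (Module.finrank ℂ V : ℂ) := by
    have := (LinearMap.isNilpotent_trace_of_isNilpotent hnil).eq_zero
    rw [map_sub, sub_eq_zero] at this
    rw [this, Algebra.algebraMap_eq_smul_one, map_smul, LinearMap.trace_one, smul_eq_mul]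
  have htr' : ∀ a, ((p ^ n : ℕ) : ℂ) * LinearMap.trace ℂ V (T a) = ω * (Module.finrank ℂ V : ℂ) := by
    intro a
    rw [← hK, map_sum, Finset.sum_congr rfl (fun b _ => htr b a)]
    simp [hcard]
  have hcop : Nat.Coprime (p ^ n) (Module.finrank ℂ V) :=
    Nat.Coprime.pow_left n ((Nat.Prime.coprime_iff_not_dvd hp).2 hnd)
  have hsc := fun a => scalar_of_trace (T a) m hm (hT a) (p ^ n) ω hω hωi hcop hN (htr' a)
  choose ζ hζ using hsc
  have hζζ : ∀ a b, ζ a = ζ b := by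
    intro a b
    have := htr a b
    rw [hζ a, hζ b, Algebra.algebraMap_eq_smul_one, Algebra.algebraMap_eq_smul_one, map_smul,
      map_smul, LinearMap.trace_one, smul_eq_mul, smul_eq_mul] at this
    exact mul_right_cancel₀ (by exact_mod_cast hN) this
  have : Nontrivial V := Module.nontrivial_of_finrank_pos (Nat.pos_of_ne_zero hN)
  obtain ⟨v, hv⟩ := exists_ne (0 : V)
  apply hv
  apply hno
  intro a b
  rw [hζ a, hζ b, hζζ a b]

open Quandles in
lemma quandle_rep_dvd_sub {Q : Type*} [Quandle Q] [Fintype Q] {p n : ℕ} (hp : p.Prime)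
    (hcard : Fintype.card Q = p ^ n)
    (hconn : ∀ φ : Q → ℂ, (∀ a b, φ (a ◃ b) = φ b) → ∀ a b, φ a = φ b)
    {V : Type*} [AddCommGroup V] [Module ℂ V] [FiniteDimensional ℂ V]
    (T : Q → Module.End ℂ V) (m : ℕ) (hm : 0 < m) (hT : ∀ a, T a ^ m = 1)
    (hTT : ∀ a b, T (a ◃ b) * T a = T a * T b) (ω : ℂ) (hω : ω ≠ 0) (hωi : IsIntegral ℤ ω)
    (V0 : Submodule ℂ V) (hV0 : ∀ a, ∀ v ∈ V0, T a v ∈ V0)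
    (hno : ∀ v ∈ V0, (∀ a b, T a v = T b v) → v = 0) :
    p ∣ Module.finrank ℂ ↥((∑ a, T a).maxGenEigenspace ω ⊓ V0) := by
  set K := ∑ a, T a with hKdef
  have hcomm : ∀ a, Commute K (T a) := by
    intro a
    show K * T a = T a * K
    rw [hKdef, Finset.sum_mul, Finset.mul_sum]
    rw [← Equiv.sum_comp (Rack.act' a) (fun b => T b * T a)]
    exact Finset.sum_congr rfl (fun b _ => hTT a b)
  set E := K.maxGenEigenspace ω ⊓ V0 with hE
  have hmaps : ∀ a, ∀ v ∈ E, T a v ∈ E := by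
    rintro a v ⟨hv1, hv2⟩
    exact ⟨Module.End.mapsTo_maxGenEigenspace_of_comm (hcomm a) ω hv1, hV0 a v hv2⟩
  let S : Q → Module.End ℂ E := fun a => (T a).restrict (hmaps a)
  have hSpow : ∀ a k (v : E), (((S a) ^ k) v : V) = ((T a) ^ k) v := by
    intro a k
    induction k with
    | zero => intro v; simp
    | succ k ih => intro v; rw [pow_succ, pow_succ]; simp [ih, S]
  refine quandle_rep_dvd hp hcard hconn S m hm ?_ ?_ ω hω hωi ?_ ?_
  · intro a
    ext v
    rw [hSpow, hT]; simp
  · intro a b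
    ext v
    have := congrArg (fun f => f (v : V)) (hTT a b)
    simpa [S] using this
  · obtain ⟨k, hk⟩ : ∃ k : ℕ, K.maxGenEigenspace ω = K.genEigenspace ω k :=
      ⟨_, Module.End.maxGenEigenspace_eq K ω⟩
    refine ⟨k, ?_⟩
    have hpow : ∀ j (v : E), ((((∑ a, S a) - algebraMap ℂ (Module.End ℂ E) ω) ^ j) v : V)
        = ((K - algebraMap ℂ (Module.End ℂ V) ω) ^ j) v := by
      intro j
      induction j with
      | zero => intro v; simp
      | succ j ih =>
        intro v
        rw [pow_succ, pow_succ, Module.End.mul_apply, Module.End.mul_apply, ih]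
        congr 1
        simp [S, hKdef, LinearMap.sum_apply]
    ext v
    rw [hpow]
    have hv : (v : V) ∈ K.genEigenspace ω k := by rw [← hk]; exact v.2.1
    rw [Module.End.mem_genEigenspace_nat, LinearMap.mem_ker] at hv
    simpa [Algebra.algebraMap_eq_smul_one] using hv
  · intro v hv
    apply Subtype.ext
    refine hno v v.2.2 ?_
    intro a b
    exact congrArg Subtype.val (hv a b)

lemma rootMult_mod_dvd {κ : Type*} [Field κ] (π : integralClosure ℤ ℂ →+* κ) (c : κ) (p : ℕ)
    (F : Polynomial (integralClosure ℤ ℂ)) (hF : F.Monic)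
    (h : ∀ o : integralClosure ℤ ℂ, π o = c →
      p ∣ (F.map (algebraMap (integralClosure ℤ ℂ) ℂ)).rootMultiplicity (o : ℂ)) :
    p ∣ (F.map π).rootMultiplicity c := by
  classical
  set ι := algebraMap (integralClosure ℤ ℂ) ℂ with hι
  have hinj : Function.Injective ι := Subtype.val_injective
  have hroots : ∀ z ∈ (F.map ι).roots, z ∈ integralClosure ℤ ℂ := by
    intro z hz
    have hz' : (F.map ι).IsRoot z := Polynomial.isRoot_of_mem_roots hz
    have h1 : IsIntegral (integralClosure ℤ ℂ) z := ⟨F, hF, by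
      rw [Polynomial.IsRoot, Polynomial.eval_map] at hz'
      exact hz'⟩
    exact isIntegral_trans (R := ℤ) (A := integralClosure ℤ ℂ) z h1
  obtain ⟨s, hs⟩ : ∃ s : Multiset (integralClosure ℤ ℂ), s.map ι = (F.map ι).roots := by
    have := CanLift.prf (α := Multiset ℂ) (β := Multiset (integralClosure ℤ ℂ)) (F.map ι).roots hroots
    exact this
  have hFs : F = (s.map (fun x => Polynomial.X - Polynomial.C x)).prod := by
    apply Polynomial.map_injective ι hinj
    have hsp : (F.map ι).Splits := IsAlgClosed.splits _
    rw [hsp.eq_prod_roots_of_monic (hF.map ι), ← hs, Polynomial.map_multiset_prod]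
    simp [Multiset.map_map]
  have hFπ : F.map π = ((s.map π).map (fun x => Polynomial.X - Polynomial.C x)).prod := by
    conv_lhs => rw [hFs]
    rw [Polynomial.map_multiset_prod]
    simp [Multiset.map_map]
  rw [← Polynomial.count_roots, hFπ, Polynomial.roots_multiset_prod_X_sub_C, Multiset.count_map,
    Multiset.filter_congr (q := fun x => π x = c) (fun x _ => eq_comm),
    ← Multiset.toFinset_sum_count_eq]
  refine Finset.dvd_sum ?_
  intro o ho
  have ho' : π o = c := by
    have := Multiset.mem_toFinset.1 ho
    exact (Multiset.mem_filter.1 this).2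
  rw [Multiset.count_filter_of_pos (p := fun x => π x = c) ho']
  have := h o ho'
  rw [← Polynomial.count_roots, ← hs] at this
  have h2 := Multiset.count_map_eq_count' ι s hinj o
  rw [← h2]
  exact this

/-- The monomial matrix attached to a twisting function. -/
def monoMat {X U R : Type*} [CommRing R] [DecidableEq U] (q : X → U) (s : U → X) (l : ℕ)
    (χ : X → R) (t : X → X) : Matrix U U R :=
  Matrix.of fun u v => if q (t (s u)) = v then χ (s u) ^ (l - 1) * χ (t (s u)) else 0

lemma monoMat_mulVec {X U R : Type*} [CommRing R] [DecidableEq U] [Fintype U] (q : X → U)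
    (s : U → X) (hqs : ∀ u, q (s u) = u) (l : ℕ) (hl : 0 < l)
    (χ : X → R) (hχ : ∀ x, χ x ^ l = 1) (t : X → X)
    (hwd : ∀ x x', q x = q x' → q (t x) = q (t x') ∧ χ x * χ (t x') = χ x' * χ (t x))
    (f : U → R) (x : X) :
    χ x * (monoMat q s l χ t).mulVec f (q x) = χ (t x) * f (q (t x)) := by
  have h1 : (monoMat q s l χ t).mulVec f (q x) =
      χ (s (q x)) ^ (l - 1) * χ (t (s (q x))) * f (q (t (s (q x)))) := by
    simp [monoMat, Matrix.mulVec, dotProduct]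
  obtain ⟨h2, h3⟩ := hwd (s (q x)) x (hqs _)
  rw [h1, h2]
  have h4 : χ (s (q x)) ^ (l - 1) * χ (s (q x)) = 1 := by
    rw [← pow_succ, Nat.sub_add_cancel hl, hχ]
  linear_combination (-χ (s (q x)) ^ (l - 1) * f (q (t x))) * h3 + χ (t x) * f (q (t x)) * h4

open Quandles in
lemma mono_dvd {Q : Type*} [Quandle Q] [Fintype Q] {p n : ℕ} (hp : p.Prime)
    (hcard : Fintype.card Q = p ^ n)
    (hconn : ∀ φ : Q → ℂ, (∀ a b, φ (a ◃ b) = φ b) → ∀ a b, φ a = φ b)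
    {X U : Type*} [DecidableEq U] [Fintype U] (q : X → U)
    (s : U → X) (hqs : ∀ u, q (s u) = u) (l : ℕ) (hl : 0 < l)
    (χ : X → integralClosure ℤ ℂ) (hχ : ∀ x, χ x ^ l = 1) (t : Q → X → X)
    (hwd : ∀ a x x', q x = q x' → q (t a x) = q (t a x') ∧ χ x * χ (t a x') = χ x' * χ (t a x))
    (ht : ∀ a b x, t a (t (a ◃ b) x) = t b (t a x)) (m : ℕ) (hm : 0 < m)
    (htm : ∀ a x, (t a)^[m] x = x)
    (V0 : Submodule ℂ (U → ℂ))
    (hV0 : ∀ a, ∀ v ∈ V0, Matrix.toLin' ((monoMat q s l χ (t a)).map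
      (algebraMap (integralClosure ℤ ℂ) ℂ)) v ∈ V0)
    (hno : ∀ f ∈ V0, (∀ a b x, (χ (t a x) : ℂ) * f (q (t a x)) = χ (t b x) * f (q (t b x))) → f = 0)
    (o : integralClosure ℤ ℂ) (ho : o ≠ 0) :
    p ∣ Module.finrank ℂ ↥(Module.End.maxGenEigenspace (Matrix.toLin'
      ((∑ a, monoMat q s l χ (t a)).map (algebraMap (integralClosure ℤ ℂ) ℂ))) (o : ℂ) ⊓ V0) := by
  set ι := algebraMap (integralClosure ℤ ℂ) ℂ with hι
  have hmap : ∀ a, (monoMat q s l χ (t a)).map ι = monoMat q s l (fun x => ι (χ x)) (t a) := by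
    intro a
    ext u v
    simp only [monoMat, Matrix.map_apply, Matrix.of_apply]
    split_ifs <;> simp
  let T : Q → Module.End ℂ (U → ℂ) := fun a => Matrix.toLin' ((monoMat q s l χ (t a)).map ι)
  have hχ0 : ∀ x, ι (χ x) ≠ 0 := by
    intro x h
    have := congrArg ι (hχ x)
    rw [map_pow, h, zero_pow hl.ne', map_one] at this
    exact zero_ne_one this
  have hT : ∀ a f x, ι (χ x) * T a f (q x) = ι (χ (t a x)) * f (q (t a x)) := by
    intro a f x
    simp only [T, hmap, Matrix.toLin'_apply]
    refine monoMat_mulVec q s hqs l hl (fun x => ι (χ x)) ?_ (t a) ?_ f x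
    · intro x; rw [← map_pow, hχ, map_one]
    · intro x x' h
      refine ⟨(hwd a x x' h).1, ?_⟩
      rw [← map_mul, (hwd a x x' h).2, map_mul]
  have hfun : ∀ f g : U → ℂ, (∀ x, ι (χ x) * f (q x) = ι (χ x) * g (q x)) → f = g := by
    intro f g h
    funext u
    have := h (s u)
    rw [hqs] at this
    exact mul_left_cancel₀ (hχ0 _) this
  have hTpow : ∀ a k f x, ι (χ x) * (T a ^ k) f (q x) = ι (χ ((t a)^[k] x)) * f (q ((t a)^[k] x)) := by
    intro a k
    induction k with
    | zero => intro f x; simp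
    | succ k ih =>
      intro f x
      rw [pow_succ', Module.End.mul_apply, hT, ih, Function.iterate_succ_apply]
  have hsum : (Matrix.toLin' ((∑ a, monoMat q s l χ (t a)).map ι)) = ∑ a, T a := by
    rw [← map_sum]
    congr 1
    exact map_sum (ι.mapMatrix) (fun a => monoMat q s l χ (t a)) Finset.univ
  rw [hsum]
  refine quandle_rep_dvd_sub hp hcard hconn T m hm ?_ ?_ (o : ℂ) ?_ o.2 V0 hV0 ?_
  · intro a
    apply LinearMap.ext
    intro f
    apply hfun
    intro x
    rw [hTpow, htm]; rfl
  · intro a b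
    apply LinearMap.ext
    intro f
    apply hfun
    intro x
    rw [Module.End.mul_apply, Module.End.mul_apply, hT, hT, hT, hT, ht]
  · intro h; apply ho; exact Subtype.ext h
  · intro f hf h
    refine hno f hf ?_
    intro a b x
    have := congrFun (h a b) (q x)
    have h2 : ι (χ x) * T a f (q x) = ι (χ x) * T b f (q x) := by rw [this]
    rw [hT, hT] at h2
    exact h2

lemma exists_residue (l : ℕ) (hl : l.Prime) : ∃ I : Ideal (integralClosure ℤ ℂ), I.IsMaximal ∧
    (l : integralClosure ℤ ℂ) ∈ I := by
  have hne : Ideal.span {(l : integralClosure ℤ ℂ)} ≠ ⊤ := by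
    intro h
    rw [Ideal.span_singleton_eq_top] at h
    obtain ⟨o, ho⟩ := h.exists_right_inv
    have h1 : (l : ℂ) * (o : ℂ) = 1 := by exact_mod_cast congrArg Subtype.val ho
    have hl0 : (l : ℂ) ≠ 0 := by exact_mod_cast hl.ne_zero
    have h2 : (o : ℂ) = algebraMap ℚ ℂ (1 / (l : ℚ)) := by
      rw [eq_comm, map_div₀, map_one, map_natCast, div_eq_iff hl0, mul_comm]
      exact h1.symm
    have h3 : IsIntegral ℤ (algebraMap ℚ ℂ (1 / (l : ℚ))) := h2 ▸ o.2
    have h4 : IsIntegral ℤ (1 / (l : ℚ)) :=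
      (isIntegral_algebraMap_iff (algebraMap ℚ ℂ).injective).1 h3
    obtain ⟨k, hk⟩ := IsIntegrallyClosed.isIntegral_iff.1 h4
    have hl0' : (l : ℚ) ≠ 0 := by exact_mod_cast hl.ne_zero
    rw [eq_div_iff hl0', eq_intCast] at hk
    have h5 : k * (l : ℤ) = 1 := by exact_mod_cast hk
    have := Int.eq_one_or_neg_one_of_mul_eq_one' h5
    have := hl.two_le
    omega
  obtain ⟨I, hI, hle⟩ := Ideal.exists_le_maximal _ hne
  exact ⟨I, hI, hle (Ideal.mem_span_singleton_self _)⟩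

open Quandles in
lemma mono_contra {Q : Type*} [Quandle Q] [Fintype Q] {p n : ℕ} (hp : p.Prime)
    (hcard : Fintype.card Q = p ^ n)
    (hconn : ∀ φ : Q → ℂ, (∀ a b, φ (a ◃ b) = φ b) → ∀ a b, φ a = φ b)
    {X U : Type*} [DecidableEq U] [Fintype U] [Nonempty U] (q : X → U)
    (s : U → X) (hqs : ∀ u, q (s u) = u) (l : ℕ) (hl : l.Prime) (hlp : l ≠ p)
    (χ : X → integralClosure ℤ ℂ) (hχ : ∀ x, χ x ^ l = 1) (t : Q → X → X)
    (hwd : ∀ a x x', q x = q x' → q (t a x) = q (t a x') ∧ χ x * χ (t a x') = χ x' * χ (t a x))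
    (ht : ∀ a b x, t a (t (a ◃ b) x) = t b (t a x)) (m : ℕ) (hm : 0 < m)
    (htm : ∀ a x, (t a)^[m] x = x)
    (hno : ∀ f : U → ℂ,
      (∀ a b x, (χ (t a x) : ℂ) * f (q (t a x)) = χ (t b x) * f (q (t b x))) → f = 0)
    (hconst : ∀ f : U → ℂ,
      (∀ a b x, f (q (t a x)) = f (q (t b x))) → ∀ u v, f u = f v) : False := by
  classical
  set ι := algebraMap (integralClosure ℤ ℂ) ℂ with hι
  obtain ⟨I, hI, hlI⟩ := exists_residue l hl
  let := Ideal.Quotient.field I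
  set π := Ideal.Quotient.mk I with hπ
  have hπl : ((l : ℕ) : integralClosure ℤ ℂ ⧸ I) = 0 := by
    rw [← map_natCast π]; exact Ideal.Quotient.eq_zero_iff_mem.2 hlI
  have hlfact : Fact l.Prime := ⟨hl⟩
  have hchar : CharP (integralClosure ℤ ℂ ⧸ I) l := by
    exact (CharP.charP_iff_prime_eq_zero hl).2 hπl
  have hπχ : ∀ x, π (χ x) = 1 := by
    intro x
    have h1 : (π (χ x) - 1) ^ l = 0 := by
      rw [sub_pow_char, one_pow, ← map_pow, hχ, map_one, sub_self]
    exact sub_eq_zero.1 (pow_eq_zero_iff hl.ne_zero |>.1 h1)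
  set o0 : integralClosure ℤ ℂ := ((p ^ n : ℕ) : integralClosure ℤ ℂ) with ho0
  have hc0 : π o0 ≠ 0 := by
    rw [ho0, map_natCast]
    intro h
    rw [CharP.cast_eq_zero_iff _ l] at h
    exact hlp ((Nat.prime_dvd_prime_iff_eq hl hp).1 (hl.dvd_of_dvd_pow h))
  let M : (X → integralClosure ℤ ℂ) → Matrix U U (integralClosure ℤ ℂ) :=
    fun χ => ∑ a, monoMat q s l χ (t a)
  have hMM : (M χ).charpoly.map π = (M (fun _ => 1)).charpoly.map π := by
    rw [← Matrix.charpoly_map, ← Matrix.charpoly_map]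
    congr 1
    ext u v
    simp only [M, Matrix.map_apply, Matrix.sum_apply, map_sum]
    refine Finset.sum_congr rfl ?_
    intro a _
    simp only [monoMat, Matrix.of_apply]
    split_ifs <;> simp [hπχ]
  have hrm : ∀ χ' (o : integralClosure ℤ ℂ), ((M χ').charpoly.map ι).rootMultiplicity (o : ℂ) =
      Module.finrank ℂ ↥(Module.End.maxGenEigenspace (Matrix.toLin' ((M χ').map ι)) (o : ℂ)) := by
    intro χ' o
    rw [LinearMap.finrank_maxGenEigenspace_eq, Matrix.charpoly_toLin', Matrix.charpoly_map]
  -- the twisted side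
  have hA : p ∣ ((M χ).charpoly.map π).rootMultiplicity (π o0) := by
    refine rootMult_mod_dvd π _ p _ (Matrix.charpoly_monic _) ?_
    intro o ho
    rw [hrm]
    have := mono_dvd hp hcard hconn q s hqs l hl.pos χ hχ t hwd ht m hm htm ⊤
      (fun _ _ _ => trivial) (fun f _ h => hno f h) o (by rintro rfl; rw [map_zero] at ho; exact hc0 ho.symm)
    rwa [inf_top_eq] at this
  -- the untwisted side
  have hT : ∀ a (f : U → ℂ), Matrix.toLin' ((monoMat q s l (fun _ => (1 : integralClosure ℤ ℂ)) (t a)).map ι) f =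
      fun u => f (q (t a (s u))) := by
    intro a f
    funext u
    simp only [Matrix.toLin'_apply, Matrix.mulVec, dotProduct, monoMat, Matrix.map_apply,
      Matrix.of_apply]
    rw [Finset.sum_eq_single (q (t a (s u)))]
    · simp
    · intro v _ hv
      rw [if_neg (Ne.symm hv)]; simp
    · simp
  let σ : (U → ℂ) →ₗ[ℂ] ℂ := ∑ u, LinearMap.proj u
  have hσ : ∀ f, σ f = ∑ u, f u := by intro f; simp [σ]
  have hbij : ∀ a, Function.Bijective (fun u => q (t a (s u))) := by
    intro a
    rw [← Finite.injective_iff_bijective]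
    have hit : ∀ k x, (fun u => q (t a (s u)))^[k] (q x) = q ((t a)^[k] x) := by
      intro k
      induction k with
      | zero => intro x; rfl
      | succ k ih =>
        intro x
        rw [Function.iterate_succ_apply, Function.iterate_succ_apply]
        rw [(hwd a (s (q x)) x (hqs _)).1, ih]
    intro u v huv
    have h1 := congrArg ((fun u => q (t a (s u)))^[m - 1]) huv
    change (fun u => q (t a (s u)))^[m - 1] ((fun u => q (t a (s u))) u) =
      (fun u => q (t a (s u)))^[m - 1] ((fun u => q (t a (s u))) v) at h1
    rw [← Function.iterate_succ_apply, ← Function.iterate_succ_apply, Nat.succ_eq_add_one,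
      Nat.sub_add_cancel hm] at h1
    have h2 := hit m (s u)
    have h3 := hit m (s v)
    rw [htm, hqs] at h2 h3
    rw [h2, h3] at h1
    exact h1
  have hσT : ∀ a f, σ (Matrix.toLin' ((monoMat q s l (fun _ => (1 : integralClosure ℤ ℂ)) (t a)).map ι) f) = σ f := by
    intro a f
    rw [hT, hσ, hσ]
    exact (hbij a).sum_comp f
  set K := Matrix.toLin' ((M (fun _ => 1)).map ι) with hK
  have hKsum : ∀ f, K f = ∑ a, Matrix.toLin' ((monoMat q s l (fun _ => (1 : integralClosure ℤ ℂ)) (t a)).map ι) f := by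
    intro f
    rw [hK, ← LinearMap.sum_apply, ← map_sum]
    congr 2
    exact map_sum (ι.mapMatrix) (fun a => monoMat q s l (fun _ => 1) (t a)) Finset.univ
  have hσK : ∀ f, σ (K f) = (o0 : ℂ) * σ f := by
    intro f
    rw [hKsum, map_sum, Finset.sum_congr rfl (fun a _ => hσT a f)]
    simp [hcard, ho0]
  have hK1 : K (fun _ => 1) = fun _ => (o0 : ℂ) := by
    rw [hKsum, Finset.sum_congr rfl (fun a _ => hT a _)]
    funext u
    simp [hcard, ho0]
  have hdv : ∀ o : integralClosure ℤ ℂ, o ≠ 0 →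
      p ∣ Module.finrank ℂ ↥(Module.End.maxGenEigenspace K (o : ℂ) ⊓ LinearMap.ker σ) := by
    intro o ho
    refine mono_dvd hp hcard hconn q s hqs l hl.pos (fun _ => 1) (fun _ => one_pow _) t
      (fun a x x' h => ⟨(hwd a x x' h).1, rfl⟩) ht m hm htm (LinearMap.ker σ) ?_ ?_ o ho
    · intro a v hv
      rw [LinearMap.mem_ker] at hv ⊢
      rw [hσT, hv]
    · intro f hf h
      have hc := hconst f (by simpa using h)
      rw [LinearMap.mem_ker, hσ] at hf
      funext u
      rw [Finset.sum_congr rfl (fun v _ => hc v u)] at hf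
      simpa using hf
  have hpow : ∀ (o : ℂ) (k : ℕ) f, σ (((K - o • 1) ^ k) f) = ((o0 : ℂ) - o) ^ k * σ f := by
    intro o k
    induction k with
    | zero => intro f; simp
    | succ k ih =>
      intro f
      rw [pow_succ, Module.End.mul_apply, ih]
      simp only [LinearMap.sub_apply, LinearMap.smul_apply, Module.End.one_apply, map_sub, hσK,
        map_smul, smul_eq_mul]
      ring
  have hne : ∀ o : integralClosure ℤ ℂ, o ≠ 0 → o ≠ o0 →
      p ∣ ((M (fun _ => 1)).charpoly.map ι).rootMultiplicity (o : ℂ) := by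
    intro o ho hoo
    rw [hrm]
    have h1 := hdv o ho
    rwa [inf_eq_left.2] at h1
    intro f hf
    obtain ⟨k, hk⟩ := (Module.End.mem_maxGenEigenspace _ _ _).1 hf
    have := hpow o k f
    rw [hk, map_zero] at this
    rw [LinearMap.mem_ker]
    rcases mul_eq_zero.1 this.symm with h | h
    · exfalso
      have := (pow_eq_zero_iff (n := k) (by rintro rfl; simp at h)).1 h
      exact hoo (Subtype.ext (sub_eq_zero.1 this).symm)
    · exact h
  have ho00 : o0 ≠ 0 := by
    intro h; rw [h, map_zero] at hc0; exact hc0 rfl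
  have hU : (Fintype.card U : ℂ) ≠ 0 := by exact_mod_cast Fintype.card_ne_zero
  have heq : ∃ j, ((M (fun _ => 1)).charpoly.map ι).rootMultiplicity (o0 : ℂ) = p * j + 1 := by
    obtain ⟨j, hj⟩ := hdv o0 ho00
    refine ⟨j, ?_⟩
    rw [hrm, ← hj]
    set E := Module.End.maxGenEigenspace K (o0 : ℂ) with hE
    have hmem : (fun _ => (1:ℂ)) ∈ E := by
      rw [hE, Module.End.mem_maxGenEigenspace]
      refine ⟨1, ?_⟩
      rw [pow_one, LinearMap.sub_apply, hK1]
      funext u; simp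
    have h1 := LinearMap.finrank_range_add_finrank_ker (σ.domRestrict E)
    have h2 : LinearMap.range (σ.domRestrict E) = ⊤ := by
      rw [LinearMap.range_eq_top]
      intro z
      refine ⟨(z / (Fintype.card U : ℂ)) • ⟨_, hmem⟩, ?_⟩
      rw [map_smul, LinearMap.domRestrict_apply, hσ]
      simp [hU]
    have h3 : Module.finrank ℂ ↥(LinearMap.ker (σ.domRestrict E)) = Module.finrank ℂ ↥(E ⊓ LinearMap.ker σ) := by
      rw [LinearMap.ker_domRestrict]
      rw [← Submodule.map_comap_subtype]
      exact (LinearEquiv.finrank_eq (Submodule.equivMapOfInjective E.subtype E.injective_subtype _))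
    rw [h2, finrank_top, Module.finrank_self, h3] at h1
    omega
  obtain ⟨j, hj⟩ := heq
  have hF0 : (M (fun _ => 1)).charpoly ≠ 0 := (Matrix.charpoly_monic _).ne_zero
  have hroot : Polynomial.X - Polynomial.C o0 ∣ (M (fun _ => 1)).charpoly := by
    rw [Polynomial.dvd_iff_isRoot]
    have : ((M (fun _ => 1)).charpoly.map ι).IsRoot (ι o0) := by
      refine (Polynomial.rootMultiplicity_pos ?_).1 ?_
      · exact ((Matrix.charpoly_monic (M (fun _ => 1))).map ι).ne_zero
      · have : ι o0 = (o0 : ℂ) := rfl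
        rw [this, hj]; omega
    exact this.of_map Subtype.val_injective
  obtain ⟨G, hG⟩ := hroot
  have hGm : G.Monic := by
    have := Matrix.charpoly_monic (M (fun _ => 1))
    rw [hG] at this
    exact (Polynomial.monic_X_sub_C o0).of_mul_monic_left this
  have hGι : ∀ o : integralClosure ℤ ℂ, ((M (fun _ => 1)).charpoly.map ι).rootMultiplicity (o : ℂ) =
      (if o = o0 then 1 else 0) + (G.map ι).rootMultiplicity (o : ℂ) := by
    intro o
    have h1 : (M (fun _ => 1)).charpoly.map ι = (Polynomial.X - Polynomial.C (o0 : ℂ)) * G.map ι := by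
      rw [hG, Polynomial.map_mul, Polynomial.map_sub, Polynomial.map_X, Polynomial.map_C]; rfl
    rw [h1, Polynomial.rootMultiplicity_mul, Polynomial.rootMultiplicity_X_sub_C]
    · congr 1
      by_cases h : o = o0
      · rw [if_pos h, if_pos (congrArg Subtype.val h)]
      · rw [if_neg h, if_neg (fun h' => h (Subtype.ext h'))]
    · exact mul_ne_zero (Polynomial.X_sub_C_ne_zero _) (hGm.map ι).ne_zero
  have hB : p ∣ (G.map π).rootMultiplicity (π o0) := by
    refine rootMult_mod_dvd π _ p _ hGm ?_
    intro o ho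
    have hoo := hGι o
    by_cases h : o = o0
    · subst h
      rw [if_pos rfl, hj] at hoo
      exact ⟨j, by show (G.map ι).rootMultiplicity _ = _; omega⟩
    · rw [if_neg h, zero_add] at hoo
      show p ∣ (G.map ι).rootMultiplicity _
      rw [← hoo]
      exact hne o (by rintro rfl; rw [map_zero] at ho; exact hc0 ho.symm) h
  rw [hMM, hG, Polynomial.map_mul, Polynomial.map_sub, Polynomial.map_X, Polynomial.map_C,
    Polynomial.rootMultiplicity_mul, Polynomial.rootMultiplicity_X_sub_C, if_pos rfl] at hA
  · have := (Nat.dvd_add_left hB).1 hA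
    exact hp.one_lt.ne' (Nat.dvd_one.1 this)
  · exact mul_ne_zero (Polynomial.X_sub_C_ne_zero _) (hGm.map π).ne_zero

section QuandleBasics
variable {Q : Type*} [Quandle Q]

lemma QL_apply (a b : Q) : QL a b = a ◃ b := rfl

lemma QL_inv_apply (a b : Q) : (QL a)⁻¹ b = a ◃⁻¹ b := rfl

lemma QL_conj (a b : Q) : QL (a ◃ b) = QL a * QL b * (QL a)⁻¹ := Rack.ad_conj a b

lemma QL_conj_inv (a b : Q) : QL (a ◃⁻¹ b) = (QL a)⁻¹ * QL b * QL a := by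
  have := QL_conj a (a ◃⁻¹ b)
  rw [Rack.act_invAct_eq] at this
  rw [this]; group

lemma QL_mem_Dis (a b : Q) : QL a * (QL b)⁻¹ ∈ Dis Q := Subgroup.subset_closure ⟨a, b, rfl⟩

lemma QL_mem_Dis' (a b : Q) : (QL a)⁻¹ * QL b ∈ Dis Q := by
  have := QL_mem_Dis (a ◃⁻¹ b) a
  rw [QL_conj_inv] at this
  simpa [mul_assoc] using this

lemma Dis_conj (c : Q) {g : Equiv.Perm Q} (hg : g ∈ Dis Q) : QL c * g * (QL c)⁻¹ ∈ Dis Q := by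
  induction hg using Subgroup.closure_induction with
  | mem x hx =>
    obtain ⟨a, b, rfl⟩ := hx
    have := QL_mem_Dis (c ◃ a) (c ◃ b)
    rw [QL_conj, QL_conj] at this
    convert this using 1
    group
  | one => simpa using (Dis Q).one_mem
  | mul x y _ _ hx hy =>
    have := (Dis Q).mul_mem hx hy
    convert this using 1
    group
  | inv x _ hx =>
    have := (Dis Q).inv_mem hx
    convert this using 1
    group

lemma Dis_aut {g : Equiv.Perm Q} (hg : g ∈ Dis Q) : ∀ c, QL (g c) = g * QL c * g⁻¹ := by
  induction hg using Subgroup.closure_induction with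
  | mem x hx =>
    obtain ⟨a, b, rfl⟩ := hx
    intro c
    rw [Equiv.Perm.mul_apply, QL_apply, QL_inv_apply, QL_conj, QL_conj_inv]
    group
  | one => intro c; simp
  | mul x y _ _ hx hy =>
    intro c
    rw [Equiv.Perm.mul_apply, hx, hy]; group
  | inv x _ hx =>
    intro c
    have := hx (x⁻¹ c)
    rw [show x (x⁻¹ c) = c from x.apply_symm_apply c] at this
    rw [this]; group

lemma simple_not_trivial (hs : IsSimpleQuandle Q) (hbig : 2 < Nat.card Q)
    (h : ∀ a b : Q, a ◃ b = b) : False := by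
  classical
  have hfin : Finite Q := Nat.finite_of_card_ne_zero (by omega)
  have := Fintype.ofFinite Q
  rw [Nat.card_eq_fintype_card] at hbig
  obtain ⟨x, y, z, hxy, hxz, hyz⟩ := Fintype.two_lt_card_iff.1 hbig
  have hi : ∀ a b : Q, a ◃⁻¹ b = b := by
    intro a b
    have := h a (a ◃⁻¹ b)
    rw [Rack.act_invAct_eq] at this
    exact this.symm
  let α : QuandleCongruence Q :=
    { rel := fun a b => (a = x ↔ b = x)
      iseqv := ⟨fun _ => Iff.rfl, fun h => h.symm, fun h h' => h.trans h'⟩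
      act_compat := by intro a b c d _ h2; rw [h, h]; exact h2
      invAct_compat := by intro a b c d _ h2; rw [hi, hi]; exact h2 }
  rcases hs α with h1 | h1
  · exact hyz ((h1 y z).1 ⟨fun h => absurd h.symm hxy, fun h => absurd h.symm hxz⟩)
  · exact hxy ((h1 x y).1 rfl).symm

lemma simple_conn (hs : IsSimpleQuandle Q) (hbig : 2 < Nat.card Q) :
    ∀ φ : Q → ℂ, (∀ a b, φ (a ◃ b) = φ b) → ∀ a b, φ a = φ b := by
  have hinv : ∀ φ : Q → ℂ, (∀ a b, φ (a ◃ b) = φ b) → ∀ a b, φ (a ◃⁻¹ b) = φ b := by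
    intro φ hφ a b
    have := hφ a (a ◃⁻¹ b)
    rw [Rack.act_invAct_eq] at this
    exact this.symm
  let α : QuandleCongruence Q :=
    { rel := fun a b => ∀ φ : Q → ℂ, (∀ a b, φ (a ◃ b) = φ b) → φ a = φ b
      iseqv := ⟨fun _ _ _ => rfl, fun h φ hφ => (h φ hφ).symm,
        fun h h' φ hφ => (h φ hφ).trans (h' φ hφ)⟩
      act_compat := by intro a b c d _ h2 φ hφ; rw [hφ, hφ]; exact h2 φ hφ
      invAct_compat := by
        intro a b c d _ h2 φ hφ; rw [hinv φ hφ, hinv φ hφ]; exact h2 φ hφ }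
  rcases hs α with h1 | h1
  · exact (simple_not_trivial hs hbig (fun a b => (h1 _ _).1 (fun φ hφ => hφ a b))).elim
  · intro φ hφ a b
    exact h1 a b φ hφ

lemma orbit_dichotomy [Finite Q] (hs : IsSimpleQuandle Q) (N : Subgroup (Equiv.Perm Q))
    (hND : N ≤ Dis Q) (hN : ∀ a, ∀ g ∈ N, QL a * g * (QL a)⁻¹ ∈ N) :
    N = ⊥ ∨ ((∀ x y : Q, ∃ g ∈ N, g x = y) ∧ Dis Q ≤ N) := by
  have hN' : ∀ a, ∀ g ∈ N, (QL a)⁻¹ * g * QL a ∈ N := by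
    intro a g hg
    let c : N → N := fun g => ⟨QL a * g * (QL a)⁻¹, hN a g g.2⟩
    have hc : Function.Injective c := by
      intro g h hgh
      have := congrArg Subtype.val hgh
      apply Subtype.ext
      simpa [c] using this
    obtain ⟨h, hh⟩ := Finite.surjective_of_injective hc ⟨g, hg⟩
    have : QL a * h * (QL a)⁻¹ = g := congrArg Subtype.val hh
    rw [← this]
    convert h.2 using 1
    group
  let α : QuandleCongruence Q :=
    { rel := fun a b => ∃ g ∈ N, g a = b
      iseqv := by
        refine ⟨fun x => ⟨1, N.one_mem, rfl⟩, ?_, ?_⟩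
        · rintro x y ⟨g, hg, rfl⟩
          exact ⟨g⁻¹, N.inv_mem hg, by simp⟩
        · rintro x y z ⟨g, hg, rfl⟩ ⟨h, hh, rfl⟩
          exact ⟨h * g, N.mul_mem hh hg, rfl⟩
      act_compat := by
        rintro a b c d ⟨g, hg, rfl⟩ ⟨h, hh, rfl⟩
        refine ⟨g * (QL a * (g⁻¹ * h) * (QL a)⁻¹), N.mul_mem hg
          (hN a _ (N.mul_mem (N.inv_mem hg) hh)), ?_⟩
        rw [← QL_apply (g a), Dis_aut (hND hg), ← QL_apply a]
        simp
      invAct_compat := by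
        rintro a b c d ⟨g, hg, rfl⟩ ⟨h, hh, rfl⟩
        refine ⟨g * ((QL a)⁻¹ * (g⁻¹ * h) * (QL a)), N.mul_mem hg
          (hN' a _ (N.mul_mem (N.inv_mem hg) hh)), ?_⟩
        rw [← QL_inv_apply (g a), Dis_aut (hND hg), ← QL_inv_apply a]
        simp [mul_assoc] }
  rcases hs α with h1 | h1
  · left
    rw [eq_bot_iff]
    intro g hg
    rw [Subgroup.mem_bot]
    ext x
    exact ((h1 x (g x)).1 ⟨g, hg, rfl⟩).symm
  · right
    have htrans : ∀ x y : Q, ∃ g ∈ N, g x = y := h1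
    refine ⟨htrans, ?_⟩
    rw [Dis, Subgroup.closure_le]
    rintro _ ⟨a, b, rfl⟩
    obtain ⟨g, hg, rfl⟩ := htrans b a
    rw [Dis_aut (hND hg)]
    have := N.mul_mem hg (hN b _ (N.inv_mem hg))
    show _ ∈ N
    convert this using 1
    group

lemma Dis_trans [Finite Q] (hs : IsSimpleQuandle Q) (hbig : 2 < Nat.card Q) :
    Dis Q ≠ ⊥ ∧ ∀ x y : Q, ∃ g ∈ Dis Q, g x = y := by
  have hne : Dis Q ≠ ⊥ := by
    intro h
    refine simple_not_trivial hs hbig ?_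
    intro a b
    have := QL_mem_Dis a b
    rw [h, Subgroup.mem_bot, mul_inv_eq_one] at this
    rw [← QL_apply, this, QL_apply, Quandle.fix]
  rcases orbit_dichotomy hs (Dis Q) le_rfl (fun a g hg => Dis_conj a hg) with h | h
  · exact absurd h hne
  · exact ⟨hne, h.1⟩

lemma Dis_no_elt [Fintype Q] {p n : ℕ} (hp : p.Prime)
    (hcard : Fintype.card Q = p ^ n)
    (hconn : ∀ φ : Q → ℂ, (∀ a b, φ (a ◃ b) = φ b) → ∀ a b, φ a = φ b)
    (l : ℕ) (hl : l.Prime) (hlp : l ≠ p) (e : Q) (y : Dis Q) (hy : orderOf y = l)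
    (hye : (y : Equiv.Perm Q) * QL e = QL e * y) : False := by
  classical
  let Y := Subgroup.zpowers y
  let q : Dis Q → Dis Q ⧸ Y := fun d => (d : Dis Q ⧸ Y)
  let s : Dis Q ⧸ Y → Dis Q := Quotient.out
  have hqs : ∀ u, q (s u) = u := fun u => Quotient.out_eq' u
  have : Fintype (Dis Q ⧸ Y) := Fintype.ofFinite _
  -- translation
  have htmem : ∀ (a : Q) (d : Dis Q), (QL a)⁻¹ * (d : Equiv.Perm Q) * QL e ∈ Dis Q := by
    intro a d
    have h1 := (Dis Q).mul_mem (QL_mem_Dis' a e) (QL_mem_Dis' e (((d : Equiv.Perm Q)) e))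
    rw [Dis_aut d.2] at h1
    have h2 := (Dis Q).mul_mem h1 d.2
    convert h2 using 1
    group
  let t : Q → Dis Q → Dis Q := fun a d => ⟨_, htmem a d⟩
  have htv : ∀ a d, (t a d : Equiv.Perm Q) = (QL a)⁻¹ * (d : Equiv.Perm Q) * QL e := fun _ _ => rfl
  have hyk : ∀ k : ℕ, ((y : Equiv.Perm Q)) ^ k * QL e = QL e * (y : Equiv.Perm Q) ^ k := by
    intro k
    exact (Commute.pow_left (show Commute _ _ from hye) k)
  have hty : ∀ a d (k : ℕ), t a (d * y ^ k) = t a d * y ^ k := by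
    intro a d k
    apply Subtype.ext
    simp only [htv, Subgroup.coe_mul, Subgroup.coe_pow, mul_assoc, hyk]
  have hq : ∀ x x', q x = q x' → ∃ k : ℕ, x' = x * y ^ k := by
    intro x x' h
    have h1 : x⁻¹ * x' ∈ Y := QuotientGroup.eq.1 h
    have h2 : x⁻¹ * x' ∈ Submonoid.powers y := (mem_powers_iff_mem_zpowers).2 h1
    obtain ⟨k, hk⟩ := h2
    refine ⟨k, ?_⟩
    have hk' : y ^ k = x⁻¹ * x' := hk
    rw [hk']; group
  have hqy : ∀ x (k : ℕ), q (x * y ^ k) = q x := by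
    intro x k
    refine (QuotientGroup.eq.2 ?_).symm
    rw [inv_mul_cancel_left]
    exact Subgroup.pow_mem _ (Subgroup.mem_zpowers y) k
  -- root of unity
  let z : ℂ := Complex.exp (2 * Real.pi * Complex.I / l)
  have hz : IsPrimitiveRoot z l := Complex.isPrimitiveRoot_exp l hl.ne_zero
  have hzi : IsIntegral ℤ z := hz.isIntegral hl.pos
  let ζ : integralClosure ℤ ℂ := ⟨z, hzi⟩
  have hζ : IsPrimitiveRoot ζ l := by
    refine IsPrimitiveRoot.of_map_of_injective (f := (integralClosure ℤ ℂ).val) ?_ Subtype.val_injective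
    exact hz
  have hk0 : ∀ d : Dis Q, ∃ k : ℕ, d = s (q d) * y ^ k := fun d => hq _ _ (hqs _)
  choose k hk using hk0
  let χ : Dis Q → integralClosure ℤ ℂ := fun d => ζ ^ k d
  have hχy : ∀ d (j : ℕ), χ (d * y ^ j) = χ d * ζ ^ j := by
    intro d j
    have h1 := hk (d * y ^ j)
    rw [hqy] at h1
    conv_lhs at h1 => rw [hk d]
    rw [mul_assoc, mul_right_inj, ← pow_add, pow_inj_mod, hy] at h1
    show ζ ^ k (d * y ^ j) = ζ ^ k d * ζ ^ j
    have e1 : ∀ m : ℕ, ζ ^ m = ζ ^ (m % l) := by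
      intro m
      conv_rhs => rw [hζ.eq_orderOf, pow_mod_orderOf]
    rw [← pow_add, e1 (k (d * y ^ j)), e1 (k d + j), h1]
  have hconst : ∀ F : Dis Q → ℂ, (∀ a b x, F (t a x) = F (t b x)) → ∀ d, F d = F 1 := by
    intro F hF
    have hgen : ∀ (g : Equiv.Perm Q) (hg : g ∈ Dis Q), ∀ d : Dis Q, F (⟨g, hg⟩ * d) = F d := by
      intro g hg
      induction hg using Subgroup.closure_induction with
      | mem x hx =>
        intro d
        obtain ⟨a, b, rfl⟩ := hx
        -- `L_a L_b⁻¹ = L_b⁻¹ L_{b ◃ a}`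
        have hm : QL (b ◃ a) * (d : Equiv.Perm Q) * (QL e)⁻¹ ∈ Dis Q := by
          have h1 := (Dis Q).mul_mem (QL_mem_Dis (b ◃ a) e) (Dis_conj e d.2)
          convert h1 using 1
          group
        have h2 := hF b (b ◃ a) ⟨_, hm⟩
        convert h2 using 2
        · apply Subtype.ext
          simp only [htv, Subgroup.coe_mul, QL_conj]
          group
        · apply Subtype.ext
          simp only [htv]
          group
      | one => intro d; exact congrArg F (one_mul d)
      | mul x y hx hy ihx ihy =>
        intro d
        exact (congrArg F (mul_assoc (⟨x, hx⟩ : Dis Q) ⟨y, hy⟩ d)).trans ((ihx _).trans (ihy d))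
      | inv x hx ih =>
        intro d
        have hx' : x ∈ Dis Q := hx
        rw [← ih]
        congr 1
        apply Subtype.ext
        simp
    intro d
    have := hgen d d.2 1
    simpa using this
  refine mono_contra hp hcard hconn q s hqs l hl hlp χ ?_ t ?_ ?_
    (Fintype.card (Equiv.Perm Q)) Fintype.card_pos ?_ ?_ ?_
  · intro x
    show (ζ ^ k x) ^ l = 1
    rw [← pow_mul, mul_comm, pow_mul, hζ.pow_eq_one, one_pow]
  · intro a x x' h
    obtain ⟨j, rfl⟩ := hq x x' h
    rw [hty, hqy, hχy, hχy]
    exact ⟨rfl, by ring⟩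
  · intro a b x
    apply Subtype.ext
    simp only [htv, QL_conj]
    group
  · intro a x
    have hit : ∀ j : ℕ, (((t a)^[j] x : Dis Q) : Equiv.Perm Q) = ((QL a)⁻¹) ^ j * x * (QL e) ^ j := by
      intro j
      induction j with
      | zero => simp
      | succ j ih =>
        rw [Function.iterate_succ_apply', htv, ih, pow_succ', pow_succ]
        simp only [mul_assoc]
    apply Subtype.ext
    rw [hit, pow_card_eq_one, pow_card_eq_one, one_mul, mul_one]
  · intro f hf
    have hc := hconst (fun d => (χ d : ℂ) * f (q d)) hf
    have h0 : (χ 1 : ℂ) * f (q 1) = 0 := by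
      have h1 : (χ (1 * y ^ 1) : ℂ) * f (q (1 * y ^ 1)) = (χ 1 : ℂ) * f (q 1) := hc (1 * y ^ 1)
      rw [hqy, hχy, pow_one] at h1
      have h2 : ((χ 1 * ζ : integralClosure ℤ ℂ) : ℂ) = (χ 1 : ℂ) * z := rfl
      rw [h2] at h1
      have h3 : ((χ 1 : ℂ) * f (q 1)) * (z - 1) = 0 := by linear_combination h1
      rcases mul_eq_zero.1 h3 with h | h
      · exact h
      · exact absurd (sub_eq_zero.1 h) (hz.ne_one hl.one_lt)
    funext u
    have h1 := hc (s u)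
    simp only [h0, hqs] at h1
    rcases mul_eq_zero.1 h1 with h | h
    · exfalso
      have h4 : (χ (s u) : ℂ) = z ^ k (s u) := rfl
      rw [h4] at h
      exact pow_ne_zero _ (hz.ne_zero hl.ne_zero) h
    · exact h
  · intro f hf u v
    have hc := hconst (fun d => f (q d)) hf
    have h1 := hc (s u)
    have h2 := hc (s v)
    simp only [hqs] at h1 h2
    rw [h1, h2]

lemma Dis_pgroup [Fintype Q] {p n : ℕ} (hp : p.Prime) (hs : IsSimpleQuandle Q)
    (hbig : 2 < Nat.card Q) (hcard : Fintype.card Q = p ^ n) : IsPGroup p (Dis Q) := by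
  classical
  have hne : Nonempty Q := (Nat.card_pos_iff.1 (by omega)).1
  obtain ⟨e⟩ := hne
  have hpp : Fact p.Prime := ⟨hp⟩
  rw [IsPGroup.iff_card]
  refine ⟨_, Nat.eq_prime_pow_of_unique_prime_dvd Nat.card_pos.ne' ?_⟩
  intro l hl hdvd
  by_contra hlp
  have hlf : Fact l.Prime := ⟨hl⟩
  have htr := (Dis_trans hs hbig).2
  have hcs : Nat.card (MulAction.orbit (Dis Q) e) * Nat.card (MulAction.stabilizer (Dis Q) e)
      = Nat.card (Dis Q) := by
    rw [← Nat.card_prod]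
    exact Nat.card_congr (MulAction.orbitProdStabilizerEquivGroup (Dis Q) e)
  have ho : MulAction.orbit (Dis Q) e = Set.univ := by
    rw [Set.eq_univ_iff_forall]
    intro x
    obtain ⟨g, hg, hgx⟩ := htr e x
    exact ⟨⟨g, hg⟩, hgx⟩
  rw [ho, Nat.card_univ, Nat.card_eq_fintype_card, hcard] at hcs
  rw [← hcs] at hdvd
  have hst : l ∣ Nat.card (MulAction.stabilizer (Dis Q) e) := by
    rcases hl.dvd_mul.1 hdvd with h | h
    · exact absurd ((Nat.prime_dvd_prime_iff_eq hl hp).1 (hl.dvd_of_dvd_pow h)) hlp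
    · exact h
  obtain ⟨y, hy⟩ := exists_prime_orderOf_dvd_card' l hst
  refine Dis_no_elt hp hcard (simple_conn hs hbig) l hl hlp e (y : Dis Q)
    (by rw [← hy]; exact Subgroup.orderOf_coe y) ?_
  have hye : ((y : Dis Q) : Equiv.Perm Q) e = e := y.2
  have := Dis_aut (y : Dis Q).2 e
  rw [hye] at this
  conv_rhs => rw [this]
  group

end QuandleBasics

lemma affine_finish {A : Type*} [AddCommGroup A] {p n : ℕ} [hpf : Fact p.Prime]
    [Module (ZMod p) A] (hA : Nat.card A = p ^ n) {Q : Type*} [Quandle Q]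
    (β : A ≃ Q) (f0 : A ≃+ A) (hβ : ∀ x y, β x ◃ β y = β (x - f0 x + f0 y))
    (hirr : ∀ W : AddSubgroup A, (∀ x ∈ W, f0 x ∈ W) → W = ⊥ ∨ W = ⊤)
    (hnt : ∃ a b : Q, a ◃ b ≠ b) :
    ∃ f : (Fin n → ZMod p) ≃ₗ[ZMod p] (Fin n → ZMod p),
      (∀ W : Submodule (ZMod p) (Fin n → ZMod p), (∀ x ∈ W, f x ∈ W) → W = ⊥ ∨ W = ⊤) ∧
        ∃ e : Q ≃ (Fin n → ZMod p),
          (∀ x y : Q, e (x ◃ y) = e x - f (e x) + f (e y)) ∧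
            ∀ a : Q, Function.Bijective (fun b : Q => b ◃ a) := by
  classical
  have hp := hpf.out
  have hfin : Finite A := Nat.finite_of_card_ne_zero (by rw [hA]; exact pow_ne_zero _ hp.ne_zero)
  have hQfin : Finite Q := Finite.of_equiv A β
  have hMF : Module.Finite (ZMod p) A := Module.Finite.of_finite
  have hrank : Module.finrank (ZMod p) A = n := by
    have h1 := Module.natCard_eq_pow_finrank (K := ZMod p) (V := A)
    rw [hA, Nat.card_zmod] at h1
    exact (Nat.pow_right_injective hp.two_le h1).symm
  let E : A ≃ₗ[ZMod p] (Fin n → ZMod p) :=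
    LinearEquiv.ofFinrankEq A (Fin n → ZMod p) (by rw [hrank, Module.finrank_fin_fun])
  let fl : A ≃ₗ[ZMod p] A :=
    { f0 with map_smul' := fun c x => ZMod.map_smul f0 c x }
  have hfl : ∀ x : A, fl x = f0 x := fun _ => rfl
  refine ⟨(E.symm.trans fl).trans E, ?_, β.symm.trans E.toEquiv, ?_, ?_⟩
  · intro W hW
    have hinvW : ∀ x ∈ (W.comap E.toLinearMap).toAddSubgroup,
        f0 x ∈ (W.comap E.toLinearMap).toAddSubgroup := by
      intro x hx
      have hx' : E x ∈ W := hx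
      have := hW _ hx'
      show E (f0 x) ∈ W
      simpa [hfl] using this
    rcases hirr (W.comap E.toLinearMap).toAddSubgroup hinvW with h | h
    · left
      rw [eq_bot_iff]
      intro x hx
      have h1 : E.symm x ∈ (W.comap E.toLinearMap).toAddSubgroup := by
        show E (E.symm x) ∈ W
        simpa using hx
      rw [h, AddSubgroup.mem_bot] at h1
      simpa using h1
    · right
      rw [eq_top_iff]
      intro x _
      have h1 : E.symm x ∈ (W.comap E.toLinearMap).toAddSubgroup := by
        rw [h]; trivial
      have h2 : E (E.symm x) ∈ W := h1
      simpa using h2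
  · intro x y
    obtain ⟨x, rfl⟩ := β.surjective x
    obtain ⟨y, rfl⟩ := β.surjective y
    rw [hβ]
    simp [hfl]
  · have hinj : ∀ x, f0 x = x → x = 0 := by
      let K : AddSubgroup A := (f0.toAddMonoidHom - AddMonoidHom.id A).ker
      have hK : ∀ x, x ∈ K ↔ f0 x = x := by
        intro x
        rw [AddMonoidHom.mem_ker]
        exact sub_eq_zero
      rcases hirr K (fun x hx => (hK _).2 (by rw [(hK x).1 hx]; exact (hK x).1 hx)) with h | h
      · intro x hx
        have := (hK x).2 hx
        rwa [h, AddSubgroup.mem_bot] at this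
      · exfalso
        obtain ⟨a, b, hab⟩ := hnt
        obtain ⟨x, rfl⟩ := β.surjective a
        obtain ⟨y, rfl⟩ := β.surjective b
        have hid : ∀ x, f0 x = x := fun x => (hK x).1 (by rw [h]; trivial)
        apply hab
        rw [hβ, hid, hid, sub_self, zero_add]
    intro a
    refine Finite.injective_iff_bijective.1 ?_
    intro b c hbc
    obtain ⟨x, rfl⟩ := β.surjective a
    obtain ⟨y, rfl⟩ := β.surjective b
    obtain ⟨z, rfl⟩ := β.surjective c
    have h1 : β y ◃ β x = β z ◃ β x := hbc
    rw [hβ, hβ, β.apply_eq_iff_eq, add_left_inj] at h1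
    have h2 : f0 (y - z) = y - z := by
      rw [map_sub, sub_eq_sub_iff_add_eq_add, add_comm (f0 y) z]
      exact (sub_eq_sub_iff_add_eq_add.1 h1).symm
    rw [sub_eq_zero.1 (hinj _ h2)]

section Final
variable {Q : Type*} [Quandle Q]

lemma Dis_comm [Finite Q] {p : ℕ} (hp : p.Prime) (hs : IsSimpleQuandle Q)
    (hbig : 2 < Nat.card Q) (hD : IsPGroup p (Dis Q)) :
    ∀ g ∈ Dis Q, ∀ h ∈ Dis Q, g * h = h * g := by
  have hpf : Fact p.Prime := ⟨hp⟩
  have hnil : Group.IsNilpotent (Dis Q) := hD.isNilpotent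
  have hN : ∀ a : Q, ∀ g ∈ ⁅Dis Q, Dis Q⁆, QL a * g * (QL a)⁻¹ ∈ ⁅Dis Q, Dis Q⁆ := by
    intro a g hg
    have h1 : (MulAut.conj (QL a)).toMonoidHom g ∈
        (⁅Dis Q, Dis Q⁆).map (MulAut.conj (QL a)).toMonoidHom := ⟨g, hg, rfl⟩
    rw [Subgroup.map_commutator] at h1
    have h2 : (Dis Q).map (MulAut.conj (QL a)).toMonoidHom ≤ Dis Q := by
      rintro _ ⟨h, hh, rfl⟩
      exact Dis_conj a hh
    exact Subgroup.commutator_mono h2 h2 h1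
  rcases orbit_dichotomy hs ⁅Dis Q, Dis Q⁆ (Subgroup.commutator_le_self _) hN with h | h
  · intro g hg h' hh
    have := Subgroup.commutator_mem_commutator hg hh
    rw [h, Subgroup.mem_bot] at this
    exact commutatorElement_eq_one_iff_mul_comm.1 this
  · exfalso
    have hnt : Nontrivial (Dis Q) := (Subgroup.nontrivial_iff_ne_bot _).2 (Dis_trans hs hbig).1
    have hlt := Group.IsSolvable.commutator_lt_top_of_nontrivial (Dis Q)
    apply hlt.ne
    rw [eq_top_iff]
    have hmap : (commutator (Dis Q)).map (Dis Q).subtype = ⁅Dis Q, Dis Q⁆ := by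
      rw [commutator_def, Subgroup.map_commutator]
      simp [← MonoidHom.range_eq_map]
    intro x _
    have hx : (x : Equiv.Perm Q) ∈ (commutator (Dis Q)).map (Dis Q).subtype := by
      rw [hmap]; exact h.2 x.2
    obtain ⟨y, hy, hyx⟩ := hx
    rwa [← Subtype.ext hyx]

lemma Dis_exp [Finite Q] {p : ℕ} (hp : p.Prime) (hs : IsSimpleQuandle Q)
    (hbig : 2 < Nat.card Q) (hD : IsPGroup p (Dis Q)) :
    ∀ g ∈ Dis Q, g ^ p = 1 := by
  have hpf : Fact p.Prime := ⟨hp⟩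
  have hcomm := Dis_comm hp hs hbig hD
  have hnt : Nontrivial (Dis Q) := (Subgroup.nontrivial_iff_ne_bot _).2 (Dis_trans hs hbig).1
  let N : Subgroup (Equiv.Perm Q) :=
    { carrier := {g | ∃ h ∈ Dis Q, h ^ p = g}
      one_mem' := ⟨1, (Dis Q).one_mem, one_pow p⟩
      mul_mem' := by
        rintro _ _ ⟨g, hg, rfl⟩ ⟨h, hh, rfl⟩
        exact ⟨g * h, (Dis Q).mul_mem hg hh, Commute.mul_pow (hcomm g hg h hh) p⟩
      inv_mem' := by
        rintro _ ⟨g, hg, rfl⟩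
        exact ⟨g⁻¹, (Dis Q).inv_mem hg, inv_pow g p⟩ }
  have hND : N ≤ Dis Q := by
    rintro _ ⟨g, hg, rfl⟩
    exact (Dis Q).pow_mem hg p
  have hN : ∀ a, ∀ g ∈ N, QL a * g * (QL a)⁻¹ ∈ N := by
    rintro a _ ⟨g, hg, rfl⟩
    exact ⟨QL a * g * (QL a)⁻¹, Dis_conj a hg, conj_pow⟩
  rcases orbit_dichotomy hs N hND hN with h | h
  · intro g hg
    have : g ^ p ∈ N := ⟨g, hg, rfl⟩
    rwa [h, Subgroup.mem_bot] at this
  · exfalso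
    have hsurj : Function.Surjective (fun x : Dis Q => x ^ p) := by
      intro x
      obtain ⟨g, hg, hgx⟩ := h.2 x.2
      exact ⟨⟨g, hg⟩, Subtype.ext hgx⟩
    have hinj := Finite.injective_iff_surjective.2 hsurj
    have hdvd : p ∣ Nat.card (Dis Q) := by
      obtain ⟨k, hk, hc⟩ := (IsPGroup.nontrivial_iff_card hD).1 hnt
      rw [hc]
      exact dvd_pow_self p hk.ne'
    obtain ⟨y, hy⟩ := exists_prime_orderOf_dvd_card' p hdvd
    have h1 : y = 1 := hinj (by
      show y ^ p = 1 ^ p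
      rw [one_pow, ← hy, pow_orderOf_eq_one])
    rw [h1, orderOf_one] at hy
    exact hp.one_lt.ne hy

end Final

theorem stmt11 (p n : ℕ) (hp : p.Prime) (hn : 1 ≤ n) (Q : Type*) [Quandle Q]
    (hsimple : IsSimpleQuandle Q) (hcard : Nat.card Q = p ^ n)
    (hbig : 2 < Nat.card Q) :
    ∃ f : (Fin n → ZMod p) ≃ₗ[ZMod p] (Fin n → ZMod p),
      (∀ W : Submodule (ZMod p) (Fin n → ZMod p), (∀ x ∈ W, f x ∈ W) → W = ⊥ ∨ W = ⊤) ∧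
        ∃ e : Q ≃ (Fin n → ZMod p),
          (∀ x y : Q, e (x ◃ y) = e x - f (e x) + f (e y)) ∧
            ∀ a : Q, Function.Bijective (fun b : Q => b ◃ a) := by
  classical
  have hfin : Finite Q := Nat.finite_of_card_ne_zero (by omega)
  let instF : Fintype Q := Fintype.ofFinite Q
  have hD : IsPGroup p (Dis Q) := Dis_pgroup hp hsimple hbig
    (by rw [← Nat.card_eq_fintype_card]; exact hcard)
  have hcomm := Dis_comm hp hsimple hbig hD
  have hexp := Dis_exp hp hsimple hbig hD
  have htr := (Dis_trans hsimple hbig).2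
  obtain ⟨e⟩ : Nonempty Q := (Nat.card_pos_iff.1 (by omega)).1
  let instC : CommGroup (Dis Q) :=
    { (inferInstance : Group (Dis Q)) with
      mul_comm := fun a b => Subtype.ext (hcomm a a.2 b b.2) }
  have hbij : Function.Bijective (fun g : Additive (Dis Q) => ((g.toMul : Dis Q) : Equiv.Perm Q) e) := by
    constructor
    · intro g h hgh
      have hgh' : ((g.toMul : Dis Q) : Equiv.Perm Q) e = ((h.toMul : Dis Q) : Equiv.Perm Q) e := hgh
      have : (g.toMul : Dis Q) = h.toMul := by
        apply Subtype.ext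
        ext x
        obtain ⟨d, hd, rfl⟩ := htr e x
        rw [← Equiv.Perm.mul_apply, ← Equiv.Perm.mul_apply, hcomm _ (g.toMul).2 d hd,
          hcomm _ (h.toMul).2 d hd, Equiv.Perm.mul_apply, Equiv.Perm.mul_apply, hgh']
      exact this
    · intro x
      obtain ⟨d, hd, hx⟩ := htr e x
      exact ⟨Additive.ofMul ⟨d, hd⟩, hx⟩
  let β : Additive (Dis Q) ≃ Q := Equiv.ofBijective _ hbij
  have hβv : ∀ g : Dis Q, β (Additive.ofMul g) = (g : Equiv.Perm Q) e := fun _ => rfl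
  let c : Dis Q →* Dis Q :=
    { toFun := fun g => ⟨QL e * g * (QL e)⁻¹, Dis_conj e g.2⟩
      map_one' := Subtype.ext (by simp)
      map_mul' := fun g h => Subtype.ext (by simp) }
  have hcv : ∀ g, (c g : Equiv.Perm Q) = QL e * g * (QL e)⁻¹ := fun _ => rfl
  have hcinj : Function.Injective c := by
    intro g h hgh
    have := congrArg (Subtype.val) hgh
    apply Subtype.ext
    simpa [hcv] using this
  let f0 : Additive (Dis Q) ≃+ Additive (Dis Q) :=
    MulEquiv.toAdditive (MulEquiv.ofBijective c (Finite.injective_iff_bijective.1 hcinj))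
  have hf0 : ∀ g : Dis Q, f0 (Additive.ofMul g) = Additive.ofMul (c g) := fun _ => rfl
  have hLe : (QL e)⁻¹ e = e := by
    rw [Equiv.Perm.inv_eq_iff_eq, QL_apply, Quandle.fix]
  have hpf : Fact p.Prime := ⟨hp⟩
  have hpA : ∀ x : Additive (Dis Q), p • x = 0 := by
    intro x
    have : (x.toMul : Dis Q) ^ p = 1 := Subtype.ext (hexp _ (x.toMul).2)
    exact this
  let instM : Module (ZMod p) (Additive (Dis Q)) := AddCommGroup.zmodModule hpA
  refine affine_finish (A := Additive (Dis Q)) ?_ β f0 ?_ ?_ ?_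
  · rw [Nat.card_congr β, hcard]
  · intro x y
    obtain ⟨g, rfl⟩ := Additive.ofMul.surjective x
    obtain ⟨h, rfl⟩ := Additive.ofMul.surjective y
    rw [hf0, hf0, ← ofMul_div, ← ofMul_mul, hβv, hβv, hβv, ← QL_apply, Dis_aut g.2]
    have h1 : g / c g * c h = g * c (g⁻¹ * h) := by
      rw [map_mul, map_inv, div_eq_mul_inv, mul_assoc]
    rw [h1]
    simp only [Subgroup.coe_mul, hcv, Equiv.Perm.mul_apply, hLe, Subgroup.coe_inv]
  · intro W hW
    let N : Subgroup (Equiv.Perm Q) := (AddSubgroup.toSubgroup' W).map (Dis Q).subtype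
    have hNv : ∀ g : Dis Q, (g : Equiv.Perm Q) ∈ N ↔ Additive.ofMul g ∈ W := by
      intro g
      constructor
      · rintro ⟨g', hg', h⟩
        have h' : g' = g := Subtype.ext h
        rw [← h']; exact hg'
      · intro h
        exact ⟨g, h, rfl⟩
    have hND : N ≤ Dis Q := by
      rintro _ ⟨g, _, rfl⟩
      exact g.2
    have hN : ∀ a, ∀ g ∈ N, QL a * g * (QL a)⁻¹ ∈ N := by
      intro a g hg
      obtain ⟨d, hd, rfl⟩ := htr e a
      have hgD := hND hg
      have h1 := hW _ ((hNv ⟨g, hgD⟩).1 hg)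
      rw [hf0, ← hNv, hcv] at h1
      have h2 : QL (d e) * g * (QL (d e))⁻¹ = QL e * g * (QL e)⁻¹ := by
        rw [Dis_aut hd]
        have h3 : d⁻¹ * g * d = g := by
          rw [mul_assoc, hcomm g hgD d hd, inv_mul_cancel_left]
        have h4 := hcomm d hd _ (Dis_conj e hgD)
        calc d * QL e * d⁻¹ * g * (d * QL e * d⁻¹)⁻¹
            = d * (QL e * (d⁻¹ * g * d) * (QL e)⁻¹) * d⁻¹ := by group
          _ = QL e * g * (QL e)⁻¹ := by rw [h3, h4, mul_inv_cancel_right]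
      rw [h2]
      exact h1
    rcases orbit_dichotomy hsimple N hND hN with h | h
    · left
      rw [eq_bot_iff]
      intro x hx
      have h1 := (hNv x.toMul).2 hx
      rw [h, Subgroup.mem_bot] at h1
      have h2 : (x.toMul : Dis Q) = 1 := Subtype.ext h1
      exact h2
    · right
      rw [eq_top_iff]
      intro x _
      exact (hNv x.toMul).1 (h.2 (x.toMul).2)
  · by_contra hcon
    push Not at hcon
    exact simple_not_trivial hsimple hbig hcon
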